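/- With blocks B_i, C_j of sizes b_i, c_j partitioning [1,d] as consecutive intervals, and m in M_{(b_i);(c_j)}, let w_m be the longest element in the double coset S_{(c_j)} w S_{(b_i)} corresponding to m. Then ℓ(m) := ℓ(w_m) = Σ_{i,j} m_{i,j} · m_{≤i,≥j} − Σ_{i,j} binom(m_{i,j}+1, 2), where m_{≤i,≥j} = Σ_{i'≤i, j'≥j} m_{i',j'}. -/

import Mathlib

open Equiv Finset

/-- `s` is one of the standard Coxeter generators (adjacent transpositions) of `S_d`. -/
def IsAdjTrans {d : ℕ} (s : Perm (Fin d)) : Prop :=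
  ∃ (i : ℕ) (h : i + 1 < d), s = Equiv.swap ⟨i, Nat.lt_of_succ_lt h⟩ ⟨i + 1, h⟩

/-- Coxeter length: minimal length of an expression of `w` as a product of
adjacent transpositions. -/
noncomputable def len {d : ℕ} (w : Perm (Fin d)) : ℕ :=
  sInf {n | ∃ l : List (Perm (Fin d)),
    l.length = n ∧ (∀ s ∈ l, IsAdjTrans s) ∧ l.prod = w}

/-- Bruhat order: `y ≤ w` iff some reduced word for `w` has a subword with product `y`. -/
def BruhatLE {d : ℕ} (y w : Perm (Fin d)) : Prop :=
  ∃ l : List (Perm (Fin d)), (∀ s ∈ l, IsAdjTrans s) ∧ l.length = len w ∧ l.prod = w ∧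
    ∃ l' : List (Perm (Fin d)), List.Sublist l' l ∧ l'.prod = y

/-- `inv_a(w) = |{a' < a : w(a') > w(a)}|`. -/
def invi {d : ℕ} (w : Perm (Fin d)) (a : Fin d) : ℕ :=
  (Finset.univ.filter (fun a' => a' < a ∧ w a < w a')).card

/-- `m` lies in `M_{(b_i);(c_j)}`: an `n × n'` matrix of nonnegative integers
with row sums `b i` and column sums `c j`. -/
def MemM {n n' : ℕ} (b : Fin n → ℕ) (c : Fin n' → ℕ) (m : Fin n → Fin n' → ℕ) : Prop :=
  (∀ i, ∑ j, m i j = b i) ∧ (∀ j, ∑ i, m i j = c j)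

/-- The block `B_i ⊆ [1,d]`: the `i`-th consecutive interval, of size `b i`. -/
def block (d : ℕ) {n : ℕ} (b : Fin n → ℕ) (i : Fin n) : Finset (Fin d) :=
  Finset.univ.filter (fun x : Fin d =>
    ∑ i' ∈ Finset.univ.filter (fun i' => i' < i), b i' ≤ (x : ℕ) ∧
    (x : ℕ) < ∑ i' ∈ Finset.univ.filter (fun i' => i' ≤ i), b i')

/-- `ψ(w)_{i,j} = |w(B_i) ∩ C_j|`. -/
def psi (d : ℕ) {n n' : ℕ} (b : Fin n → ℕ) (c : Fin n' → ℕ) (w : Perm (Fin d)) :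
    Fin n → Fin n' → ℕ :=
  fun i j => ((block d b i).filter (fun x => w x ∈ block d c j)).card

/-- `w` lies in the parabolic subgroup preserving each block `B_i` separately. -/
def PreservesBlocks (d : ℕ) {n : ℕ} (b : Fin n → ℕ) (w : Perm (Fin d)) : Prop :=
  ∀ i : Fin n, ∀ x ∈ block d b i, w x ∈ block d b i

/-- `m_{≤i,≥j} = Σ_{i'≤i, j'≥j} m_{i',j'}`. -/
def sUR {n n' : ℕ} (m : Fin n → Fin n' → ℕ) (i : Fin n) (j : Fin n') : ℕ :=
  ∑ i' ∈ Finset.univ.filter (fun i' => i' ≤ i),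
    ∑ j' ∈ Finset.univ.filter (fun j' => j ≤ j'), m i' j'

/-- `m_{≥i,≤j} = Σ_{i'≥i, j'≤j} m_{i',j'}`. -/
def sLL {n n' : ℕ} (m : Fin n → Fin n' → ℕ) (i : Fin n) (j : Fin n') : ℕ :=
  ∑ i' ∈ Finset.univ.filter (fun i' => i ≤ i'),
    ∑ j' ∈ Finset.univ.filter (fun j' => j' ≤ j), m i' j'

/-- The set of inversions. -/
def invSet {d : ℕ} (w : Perm (Fin d)) : Finset (Fin d × Fin d) :=
  Finset.univ.filter (fun p => p.1 < p.2 ∧ w p.2 < w p.1)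

lemma mem_invSet {d : ℕ} (w : Perm (Fin d)) (p q : Fin d) :
    (p, q) ∈ invSet w ↔ p < q ∧ w q < w p := by
  simp [invSet]

/-- The adjacent transposition. -/
def adj {d : ℕ} (i : ℕ) (h : i + 1 < d) : Perm (Fin d) :=
  Equiv.swap ⟨i, Nat.lt_of_succ_lt h⟩ ⟨i + 1, h⟩

lemma adj_val {d : ℕ} (i : ℕ) (h : i + 1 < d) (x : Fin d) :
    ((adj i h x : Fin d) : ℕ) = if (x : ℕ) = i then i + 1 else if (x : ℕ) = i + 1 then i else x := by
  unfold adj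
  rw [Equiv.swap_apply_def]
  simp only [Fin.ext_iff]
  split_ifs <;> rfl

lemma adj_adj {d : ℕ} (i : ℕ) (h : i + 1 < d) (x : Fin d) : adj i h (adj i h x) = x := by
  simp [adj]

lemma adj_mul_self {d : ℕ} (i : ℕ) (h : i + 1 < d) : adj i h * adj i h = 1 := by
  simp [adj]

lemma adj_left {d : ℕ} (i : ℕ) (h : i + 1 < d) : adj i h ⟨i, Nat.lt_of_succ_lt h⟩ = ⟨i + 1, h⟩ := by
  simp [adj]

lemma adj_right {d : ℕ} (i : ℕ) (h : i + 1 < d) : adj i h ⟨i + 1, h⟩ = ⟨i, Nat.lt_of_succ_lt h⟩ := by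
  simp [adj]

lemma inv_mul_adj {d : ℕ} (w : Perm (Fin d)) (i : ℕ) (h : i + 1 < d)
    (hlt : w ⟨i, Nat.lt_of_succ_lt h⟩ < w ⟨i + 1, h⟩) :
    (invSet (w * adj i h)).card = (invSet w).card + 1 := by
  have key : invSet (w * adj i h) = insert (⟨i, Nat.lt_of_succ_lt h⟩, ⟨i + 1, h⟩)
      ((invSet w).map (Equiv.prodCongr (adj i h) (adj i h)).toEmbedding) := by
    ext ⟨p, q⟩
    rw [Finset.mem_insert, Finset.mem_map_equiv]
    have e : (Equiv.prodCongr (adj i h) (adj i h)).symm (p, q) = (adj i h p, adj i h q) := by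
      rw [Equiv.symm_apply_eq]; simp [adj_adj]
    rw [e]
    simp only [mem_invSet, Perm.mul_apply, Prod.mk.injEq]
    by_cases hpq : p = ⟨i, Nat.lt_of_succ_lt h⟩ ∧ q = ⟨i + 1, h⟩
    · obtain ⟨rfl, rfl⟩ := hpq
      simp only [adj_left, adj_right, and_self, true_or, iff_true]
      exact ⟨by simp [Fin.lt_def], hlt⟩
    · simp only [hpq, false_or]
      by_cases hqp : q = ⟨i, Nat.lt_of_succ_lt h⟩ ∧ p = ⟨i + 1, h⟩
      · obtain ⟨rfl, rfl⟩ := hqp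
        simp only [adj_left, adj_right]
        constructor
        · rintro ⟨h1, h2⟩
          simp [Fin.lt_def] at h1
        · rintro ⟨h1, h2⟩
          exact absurd h2 (not_lt.2 hlt.le)
      · refine and_congr ?_ Iff.rfl
        simp only [Fin.ext_iff] at hpq hqp
        rw [Fin.lt_def, Fin.lt_def, adj_val, adj_val]
        split_ifs <;> omega
  rw [key, Finset.card_insert_of_notMem, Finset.card_map]
  rw [Finset.mem_map_equiv]
  have e : (Equiv.prodCongr (adj i h) (adj i h)).symm
      (⟨i, Nat.lt_of_succ_lt h⟩, ⟨i + 1, h⟩) = (⟨i + 1, h⟩, ⟨i, Nat.lt_of_succ_lt h⟩) := by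
    rw [Equiv.symm_apply_eq]; simp [adj_left, adj_right]
  rw [e, mem_invSet]
  rintro ⟨h1, -⟩
  simp at h1

lemma inv_mul_adj' {d : ℕ} (w : Perm (Fin d)) (i : ℕ) (h : i + 1 < d)
    (hlt : w ⟨i + 1, h⟩ < w ⟨i, Nat.lt_of_succ_lt h⟩) :
    (invSet w).card = (invSet (w * adj i h)).card + 1 := by
  have := inv_mul_adj (w * adj i h) i h (by simpa [adj_left, adj_right] using hlt)
  rwa [mul_assoc, adj_mul_self, mul_one] at this

lemma card_inv_inv {d : ℕ} (w : Perm (Fin d)) : (invSet w⁻¹).card = (invSet w).card := by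
  symm
  apply Finset.card_bij (fun p _ => (w p.2, w p.1))
  · rintro ⟨p, q⟩ hp
    simpa [invSet, and_comm] using hp
  · rintro ⟨p, q⟩ _ ⟨p', q'⟩ _ h
    simp at h
    simp [h]
  · rintro ⟨p, q⟩ hp
    refine ⟨(w⁻¹ q, w⁻¹ p), ?_, by simp⟩
    simpa [invSet, and_comm] using hp

/-- Adjacent descents inside fibres give descents inside fibres. -/
lemma anti_of_adj {d n : ℕ} (f : Fin d → Fin d) (r : Fin d → Fin n) (hr : Monotone r)
    (ha : ∀ (i : ℕ) (h : i + 1 < d), r ⟨i, Nat.lt_of_succ_lt h⟩ = r ⟨i + 1, h⟩ →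
      f ⟨i + 1, h⟩ < f ⟨i, Nat.lt_of_succ_lt h⟩)
    (x y : Fin d) (hxy : x < y) (he : r x = r y) : f y < f x := by
  obtain ⟨x, hx⟩ := x
  obtain ⟨y, hy⟩ := y
  obtain ⟨k, rfl⟩ : ∃ k, y = x + 1 + k := ⟨y - (x + 1), by simp [Fin.lt_def] at hxy; omega⟩
  induction k with
  | zero => exact ha x hy he
  | succ k ih =>
    have h1 : r ⟨x, hx⟩ ≤ r ⟨x + 1 + k, by omega⟩ := hr (by simp [Fin.le_def]; omega)
    have h2 : r ⟨x + 1 + k, by omega⟩ ≤ r ⟨x + 1 + (k + 1), hy⟩ := hr (by simp [Fin.le_def])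
    have h3 : r ⟨x, hx⟩ = r ⟨x + 1 + k, by omega⟩ := le_antisymm h1 (h2.trans he.ge)
    have h4 := ih (by omega) (by simp [Fin.lt_def]; omega) h3
    exact (ha (x + 1 + k) hy (h3.symm.trans he)).trans h4

lemma exists_word {d : ℕ} (N : ℕ) : ∀ w : Perm (Fin d), (invSet w).card = N →
    ∃ l : List (Perm (Fin d)), l.length = N ∧ (∀ s ∈ l, IsAdjTrans s) ∧ l.prod = w := by
  induction N with
  | zero =>
    intro w hw
    refine ⟨[], rfl, by simp, ?_⟩
    rw [Finset.card_eq_zero] at hw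
    have hmono : StrictMono w := by
      intro p q hpq
      by_contra hcon
      have hne : w p ≠ w q := fun e => hpq.ne (w.injective e)
      have : (p, q) ∈ invSet w := by
        simp only [invSet, Finset.mem_filter, Finset.mem_univ, true_and]
        exact ⟨hpq, lt_of_le_of_ne (not_lt.1 hcon) hne.symm⟩
      rw [hw] at this
      simp at this
    have h1 : (⇑w : Fin d → Fin d) = id := by
      have : Subsingleton (Fin d ≃o Fin d) := inferInstance
      have e := Subsingleton.elim (hmono.orderIsoOfSurjective _ w.surjective) (OrderIso.refl _)
      funext x
      exact congrArg (fun g : Fin d ≃o Fin d => g x) e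
    ext x
    simp [h1]
  | succ N ih =>
    intro w hw
    have : ∃ (i : ℕ) (h : i + 1 < d), w ⟨i + 1, h⟩ < w ⟨i, Nat.lt_of_succ_lt h⟩ := by
      by_contra hcon
      push Not at hcon
      obtain ⟨⟨p, q⟩, hp⟩ := Finset.card_pos.1 (by omega : 0 < (invSet w).card)
      simp only [invSet, Finset.mem_filter, Finset.mem_univ, true_and] at hp
      have := anti_of_adj (fun x => Fin.rev (w x)) (fun _ => (0 : Fin 1)) (fun _ _ _ => le_rfl)
        (fun i h _ => by
          rw [Fin.rev_lt_rev]
          refine lt_of_le_of_ne (hcon i h) (fun e => ?_)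
          have := w.injective e
          simp at this) p q hp.1 rfl
      rw [Fin.rev_lt_rev] at this
      exact absurd this hp.2.not_gt
    obtain ⟨i, h, hi⟩ := this
    obtain ⟨l, hl, hs, hprod⟩ := ih (w * adj i h) (by have := inv_mul_adj' w i h hi; omega)
    refine ⟨l ++ [adj i h], by simp [hl], ?_, ?_⟩
    · intro s hs'
      rw [List.mem_append, List.mem_singleton] at hs'
      rcases hs' with hs' | rfl
      · exact hs s hs'
      · exact ⟨i, h, rfl⟩
    · rw [List.prod_append, hprod, List.prod_singleton, mul_assoc, adj_mul_self, mul_one]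

lemma inv_le_word {d : ℕ} (l : List (Perm (Fin d))) (hl : ∀ s ∈ l, IsAdjTrans s) :
    (invSet l.prod).card ≤ l.length := by
  induction l using List.reverseRecOn with
  | nil =>
    simp only [List.prod_nil, List.length_nil, Nat.le_zero, Finset.card_eq_zero]
    ext ⟨p, q⟩
    rw [mem_invSet]
    simp
    exact fun h => h.le
  | append_singleton l s ih =>
    obtain ⟨i, h, hs⟩ := hl s (by simp)
    have hs' : s = adj i h := hs
    have h1 := ih (fun s hs => hl s (by simp [hs]))
    rw [List.prod_append, List.prod_singleton, List.length_append, List.length_singleton, hs']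
    rcases lt_trichotomy (l.prod ⟨i, Nat.lt_of_succ_lt h⟩) (l.prod ⟨i + 1, h⟩) with h2 | h2 | h2
    · have := inv_mul_adj _ i h h2
      omega
    · have := l.prod.injective h2
      simp at this
    · have := inv_mul_adj' _ i h h2
      omega

lemma len_eq {d : ℕ} (w : Perm (Fin d)) : len w = (invSet w).card := by
  apply le_antisymm
  · exact Nat.sInf_le (exists_word _ w rfl)
  · have hne : {n | ∃ l : List (Perm (Fin d)),
        l.length = n ∧ (∀ s ∈ l, IsAdjTrans s) ∧ l.prod = w}.Nonempty :=
      ⟨(invSet w).card, exists_word _ w rfl⟩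
    obtain ⟨l, h1, hl, h2⟩ := Nat.sInf_mem hne
    unfold len
    rw [← h1]
    conv_lhs => rw [← h2]
    exact inv_le_word l hl

lemma exists_block {d n : ℕ} (b : Fin n → ℕ) (hb : ∑ i, b i = d) (x : Fin d) :
    ∃ i, x ∈ block d b i := by
  have hex : ∃ k : ℕ, (x : ℕ) < ∑ i' ∈ Finset.univ.filter (fun i' : Fin n => (i' : ℕ) < k), b i' := by
    refine ⟨n, ?_⟩
    rw [Finset.filter_true_of_mem (fun i _ => i.2), hb]
    exact x.2
  classical
  have h1 := Nat.find_spec hex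
  have h2 := fun k (hk : k < Nat.find hex) => Nat.find_min hex hk
  have h3 : Nat.find hex ≤ n := by
    apply Nat.find_min'
    rw [Finset.filter_true_of_mem (fun i _ => i.2), hb]
    exact x.2
  generalize Nat.find hex = k at *
  cases k with
  | zero => simp at h1
  | succ k =>
    refine ⟨⟨k, h3⟩, ?_⟩
    have h4 := h2 k (by omega)
    simp only [block, Finset.mem_filter, Finset.mem_univ, true_and, Fin.lt_def, Fin.le_def]
    refine ⟨not_lt.1 h4, ?_⟩
    simpa only [Nat.lt_succ_iff] using h1

lemma block_lt {d n : ℕ} (b : Fin n → ℕ) (x y : Fin d) (i j : Fin n)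
    (hx : x ∈ block d b i) (hy : y ∈ block d b j) (hij : i < j) : x < y := by
  simp only [block, Finset.mem_filter, Finset.mem_univ, true_and] at hx hy
  have : ∑ i' ∈ Finset.univ.filter (fun i' => i' ≤ i), b i' ≤
      ∑ i' ∈ Finset.univ.filter (fun i' => i' < j), b i' := by
    apply Finset.sum_le_sum_of_subset
    intro k hk
    simp only [Finset.mem_filter, Finset.mem_univ, true_and] at hk ⊢
    exact lt_of_le_of_lt hk hij
  rw [Fin.lt_def]
  omega

/-- index of the block -/
lemma exists_index {d n : ℕ} (b : Fin n → ℕ) (hb : ∑ i, b i = d) :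
    ∃ r : Fin d → Fin n, Monotone r ∧ ∀ x i, x ∈ block d b i ↔ r x = i := by
  choose r hr using exists_block b hb
  refine ⟨r, ?_, ?_⟩
  · intro x y hxy
    by_contra h
    exact absurd (block_lt b y x _ _ (hr y) (hr x) (not_le.1 h)) (not_lt.2 hxy)
  · intro x i
    constructor
    · intro h
      rcases lt_trichotomy (r x) i with h1 | h1 | h1
      · exact absurd (block_lt b x x _ _ (hr x) h h1) (lt_irrefl _)
      · exact h1
      · exact absurd (block_lt b x x _ _ h (hr x) h1) (lt_irrefl _)
    · rintro rfl
      exact hr x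

lemma card_pairs {d : ℕ} (s : Finset (Fin d)) :
    ((s ×ˢ s).filter (fun p => p.2 ≤ p.1)).card = Nat.choose (s.card + 1) 2 := by
  induction s using Finset.induction_on_max with
  | empty => simp
  | insert a s ha ih =>
    have hns : a ∉ s := fun h => lt_irrefl _ (ha a h)
    have e : ((insert a s ×ˢ insert a s).filter (fun p => p.2 ≤ p.1)) =
        ((s ×ˢ s).filter (fun p => p.2 ≤ p.1)) ∪ ({a} ×ˢ insert a s) := by
      ext ⟨p, q⟩
      simp only [Finset.mem_filter, Finset.mem_product, Finset.mem_insert, Finset.mem_union,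
        Finset.mem_singleton]
      constructor
      · rintro ⟨⟨rfl | hp, hq⟩, hle⟩
        · exact Or.inr ⟨rfl, hq⟩
        · rcases hq with rfl | hq
          · exact absurd (ha p hp) (not_lt.2 hle)
          · exact Or.inl ⟨⟨hp, hq⟩, hle⟩
      · rintro (⟨⟨hp, hq⟩, hle⟩ | ⟨rfl, hq⟩)
        · exact ⟨⟨Or.inr hp, Or.inr hq⟩, hle⟩
        · refine ⟨⟨Or.inl rfl, hq⟩, ?_⟩
          rcases hq with rfl | hq
          · exact le_rfl
          · exact (ha q hq).le
    rw [e, Finset.card_union_of_disjoint, ih, Finset.card_product, Finset.card_singleton,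
      Finset.card_insert_of_notMem hns, Nat.choose_succ_succ' (s.card + 1) 1, Nat.choose_one_right]
    · ring
    · rw [Finset.disjoint_left]
      rintro ⟨p, q⟩ h1 h2
      simp only [Finset.mem_filter, Finset.mem_product, Finset.mem_singleton] at h1 h2
      exact hns (h2.1 ▸ h1.1.1)

lemma count {d n n' : ℕ} (R : Fin d → Fin n) (C : Fin d → Fin n') (w : Perm (Fin d))
    (m : Fin n → Fin n' → ℕ)
    (hm : ∀ i j, m i j = (Finset.univ.filter (fun x => R x = i ∧ C x = j)).card)
    (hR : Monotone R) (hC : ∀ x y, w x ≤ w y → C x ≤ C y)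
    (h1 : ∀ x y, x < y → R x = R y → w y < w x)
    (h2 : ∀ x y, w x < w y → C x = C y → y < x) :
    (invSet w).card + ∑ i, ∑ j, Nat.choose (m i j + 1) 2 = ∑ i, ∑ j, m i j * sUR m i j := by
  classical
  have hS : ∀ i j, sUR m i j = (Finset.univ.filter (fun x => R x ≤ i ∧ j ≤ C x)).card := by
    intro i j
    unfold sUR
    rw [← Finset.sum_product',
      Finset.card_eq_sum_card_fiberwise (f := fun x => (R x, C x))
      (t := (Finset.univ.filter (fun i' => i' ≤ i)) ×ˢ (Finset.univ.filter (fun j' => j ≤ j')))]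
    · apply Finset.sum_congr rfl
      rintro ⟨i', j'⟩ h
      simp only [Finset.mem_product, Finset.mem_filter, Finset.mem_univ, true_and] at h
      rw [hm]
      congr 1
      ext x
      simp only [Finset.mem_filter, Finset.mem_univ, true_and, Prod.mk.injEq]
      constructor
      · rintro ⟨rfl, rfl⟩; exact ⟨h, rfl, rfl⟩
      · exact fun h => h.2
    · intro x hx
      simpa using hx
  have hT : ∑ i, ∑ j, m i j * sUR m i j =
      ((Finset.univ : Finset (Fin d × Fin d)).filter
        (fun p => R p.1 ≤ R p.2 ∧ C p.2 ≤ C p.1)).card := by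
    rw [← Finset.sum_product', Finset.card_eq_sum_card_fiberwise
      (f := fun p => (R p.2, C p.2)) (t := Finset.univ ×ˢ Finset.univ) (by intro x _; simp)]
    apply Finset.sum_congr rfl
    rintro ⟨i, j⟩ _
    rw [hS, hm, mul_comm, ← Finset.card_product]
    congr 1
    ext ⟨x, y⟩
    simp only [Finset.mem_filter, Finset.mem_univ, true_and, Prod.mk.injEq, Finset.mem_product]
    constructor
    · rintro ⟨h, rfl, rfl⟩; exact ⟨h, rfl, rfl⟩
    · rintro ⟨h, rfl, rfl⟩; exact ⟨h, rfl, rfl⟩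
  have hK : ∑ i, ∑ j, Nat.choose (m i j + 1) 2 =
      ((Finset.univ : Finset (Fin d × Fin d)).filter
        (fun p => R p.1 = R p.2 ∧ C p.1 = C p.2 ∧ p.2 ≤ p.1)).card := by
    rw [← Finset.sum_product', Finset.card_eq_sum_card_fiberwise
      (f := fun p => (R p.2, C p.2)) (t := Finset.univ ×ˢ Finset.univ) (by intro x _; simp)]
    apply Finset.sum_congr rfl
    rintro ⟨i, j⟩ _
    rw [hm, ← card_pairs]
    congr 1
    ext ⟨x, y⟩
    simp only [Finset.mem_filter, Finset.mem_univ, true_and, Prod.mk.injEq, Finset.mem_product]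
    constructor
    · rintro ⟨⟨⟨h1, h2⟩, rfl, rfl⟩, h⟩; exact ⟨⟨h1, h2, h⟩, rfl, rfl⟩
    · rintro ⟨⟨h1, h2, h⟩, rfl, rfl⟩; exact ⟨⟨⟨h1, h2⟩, rfl, rfl⟩, h⟩
  rw [hT, hK, ← Finset.card_union_of_disjoint]
  · congr 1
    ext ⟨x, y⟩
    simp only [invSet, Finset.mem_filter, Finset.mem_univ, true_and, Finset.mem_union]
    constructor
    · rintro (⟨h, h'⟩ | ⟨h, h', -⟩)
      · exact ⟨hR h.le, hC _ _ h'.le⟩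
      · exact ⟨h.le, h'.ge⟩
    · rintro ⟨h, h'⟩
      rcases lt_or_ge x y with hxy | hxy
      · left
        refine ⟨hxy, ?_⟩
        by_contra hcon
        have h3 := hC _ _ (not_lt.1 hcon)
        have h4 : w x < w y := lt_of_le_of_ne (not_lt.1 hcon) (fun e => hxy.ne (w.injective e))
        exact absurd (h2 x y h4 (le_antisymm h3 h')) (not_lt.2 hxy.le)
      · right
        have h3 : R x = R y := le_antisymm h (hR hxy)
        refine ⟨h3, ?_, hxy⟩
        rcases hxy.lt_or_eq with h4 | rfl
        · exact le_antisymm (hC _ _ (h1 y x h4 h3.symm).le) h'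
        · rfl
  · rw [Finset.disjoint_left]
    rintro ⟨x, y⟩ h1 h2
    simp only [invSet, Finset.mem_filter, Finset.mem_univ, true_and] at h1 h2
    exact absurd h1.1 (not_lt.2 h2.2.2)

lemma adj_fix {d n : ℕ} (r : Fin d → Fin n) (i : ℕ) (h : i + 1 < d)
    (he : r ⟨i, Nat.lt_of_succ_lt h⟩ = r ⟨i + 1, h⟩) (x : Fin d) : r (adj i h x) = r x := by
  unfold adj
  rw [Equiv.swap_apply_def]
  split_ifs with h1 h2
  · rw [h1, he]
  · rw [h2, he]
  · rfl

/-- if `w_m` is the longest element of the double coset `ψ⁻¹(m)`, then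
`ℓ(w_m) = Σ_{i,j} m_{i,j}·m_{≤i,≥j} − Σ_{i,j} binom(m_{i,j}+1, 2)` (stated additively). -/
theorem stmt9 (d n n' : ℕ) (b : Fin n → ℕ) (c : Fin n' → ℕ)
    (hb : ∑ i, b i = d) (hc : ∑ j, c j = d)
    (m : Fin n → Fin n' → ℕ) (hm : MemM b c m)
    (w : Perm (Fin d)) (hw : psi d b c w = m)
    (hmax : ∀ y : Perm (Fin d), psi d b c y = m → len y ≤ len w) :
    len w + ∑ i, ∑ j, Nat.choose (m i j + 1) 2 = ∑ i, ∑ j, m i j * sUR m i j := by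
  obtain ⟨r, hr, hrb⟩ := exists_index b hb
  obtain ⟨q, hq, hqc⟩ := exists_index c hc
  have hpsi : ∀ (y : Perm (Fin d)) i j, psi d b c y i j =
      (Finset.univ.filter (fun x => r x = i ∧ q (y x) = j)).card := by
    intro y i j
    unfold psi
    congr 1
    ext x
    simp [hrb, hqc]
  rw [len_eq]
  simp only [len_eq] at hmax
  refine count r (fun x => q (w x)) w m (fun i j => by rw [← hw, hpsi]) hr
    (fun x y h => hq h) ?_ ?_
  · refine anti_of_adj w r hr (fun i h he => ?_)
    by_contra hcon
    have hne : w ⟨i, Nat.lt_of_succ_lt h⟩ ≠ w ⟨i + 1, h⟩ := fun e => by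
      have := w.injective e
      simp at this
    have h1 := inv_mul_adj w i h (lt_of_le_of_ne (not_lt.1 hcon) hne)
    have h2 := hmax (w * adj i h) (by
      rw [← hw]
      funext i' j'
      rw [hpsi, hpsi]
      apply Finset.card_bij (fun x _ => adj i h x)
      · intro x hx
        rw [Finset.mem_filter] at hx ⊢
        simpa [adj_fix r i h he] using hx
      · intro x _ y _ hxy
        exact (adj i h).injective hxy
      · intro x hx
        refine ⟨adj i h x, ?_, adj_adj i h x⟩
        rw [Finset.mem_filter] at hx ⊢
        simpa [adj_fix r i h he, adj_adj] using hx)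
    omega
  · have key := anti_of_adj (⇑w⁻¹) q hq (fun i h he => by
      by_contra hcon
      have hne : w⁻¹ ⟨i, Nat.lt_of_succ_lt h⟩ ≠ w⁻¹ ⟨i + 1, h⟩ := fun e => by
        have := w⁻¹.injective e
        simp at this
      have h1 := inv_mul_adj w⁻¹ i h (lt_of_le_of_ne (not_lt.1 hcon) hne)
      have h3 : adj i h * w = (w⁻¹ * adj i h)⁻¹ := by
        rw [mul_inv_rev, inv_inv]
        refine congrArg (· * w) ?_
        exact eq_inv_of_mul_eq_one_left (adj_mul_self i h)
      have h2 := hmax (adj i h * w) (by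
        rw [← hw]
        funext i' j'
        rw [hpsi, hpsi]
        simp [adj_fix q i h he])
      rw [h3, card_inv_inv, h1, card_inv_inv] at h2
      omega)
    intro x y h he
    simpa using key (w x) (w y) h he
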